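/- arXiv:math/0504230 — 3 statements merged into one kernel-verified Lean document; each statement's English description precedes it below -/
import Mathlib

section
/- (Brion's theorem for rational simplices) Let v_0, …, v_d ∈ ℚ^d be affinely independent and let S be their convex hull. For each i and each j ≠ i choose a nonzero vector w_{ij} ∈ ℤ^d that is a positive rational multiple of v_j − v_i, and let Π_i = {v_i + Σ_{j≠i} t_j·w_{ij} : 0 ≤ t_j < 1 for all j ≠ i} be the half-open fundamental parallelepiped of the vertex cone at v_i. Then, in the fraction field of the Laurent polynomial ring ℚ[z_1^{±1}, …, z_d^{±1}], one has Σ_{i=0}^{d} ( Σ_{m ∈ Π_i ∩ ℤ^d} z^m ) / ∏_{j≠i} (1 − z^{w_{ij}}) = Σ_{m ∈ S ∩ ℤ^d} z^m, where both numerator sums and the right-hand side are finite Laurent polynomials (written with monomial notation z^m = z_1^{m_1}⋯z_d^{m_d}). -/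
open Set Pointwise

noncomputable section

/-- The Laurent monomial `z^m = z₁^{m₁} ⋯ z_d^{m_d}` in the multivariate Laurent
polynomial ring `ℚ[z₁^{±1}, …, z_d^{±1}]` (the group algebra of `ℤ^d` over `ℚ`),
viewed in its fraction field. -/
def zpow (d : ℕ) (m : Fin d → ℤ) :
    FractionRing (AddMonoidAlgebra ℚ (Fin d → ℤ)) :=
  algebraMap (AddMonoidAlgebra ℚ (Fin d → ℤ))
    (FractionRing (AddMonoidAlgebra ℚ (Fin d → ℤ)))
    (AddMonoidAlgebra.single m 1)

/-- Translation of functions on `G`, as a representation of the multiplicative copy of `G`. -/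
def translation (G : Type*) [AddCommGroup G] :
    Multiplicative G →* Module.End ℚ (G → ℚ) where
  toFun g := LinearMap.funLeft ℚ ℚ fun m => m - g.toAdd
  map_one' := by ext; simp [LinearMap.funLeft]
  map_mul' g h := by
    refine LinearMap.ext fun f => funext fun m => ?_
    simp [LinearMap.funLeft_apply, sub_sub]

/-- The action of the group algebra `ℚ[G]` on arbitrary (not necessarily finitely supported)
functions on `G`, by convolution. -/
def convolution (G : Type*) [AddCommGroup G] :
    AddMonoidAlgebra ℚ G →ₐ[ℚ] Module.End ℚ (G → ℚ) :=
  AddMonoidAlgebra.lift ℚ (Module.End ℚ (G → ℚ)) G (translation G)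

section Convolution

variable {G : Type*} [AddCommGroup G]

lemma convolution_single (g : G) (r : ℚ) (f : G → ℚ) (m : G) :
    convolution G (AddMonoidAlgebra.single g r) f m = r * f (m - g) := by
  simp [convolution, translation, LinearMap.funLeft_apply]

lemma convolution_one_sub_single (g : G) (f : G → ℚ) (m : G) :
    convolution G (1 - AddMonoidAlgebra.single g 1) f m = f m - f (m - g) := by
  simp [convolution_single]

lemma convolution_coeff (a b : AddMonoidAlgebra ℚ G) :
    convolution G a b.coeff = (a * b).coeff := by
  induction a using AddMonoidAlgebra.induction_linear with
  | zero => ext; simp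
  | add x y hx hy => simp [add_mul, hx, hy]
  | single g r =>
    ext m
    rw [convolution_single, AddMonoidAlgebra.coeff_single_mul_apply]
    congr 2
    abel

end Convolution

section Brion

variable {G ι : Type*} [Fintype ι] [DecidableEq ι]

/-- The indicator function of the set of points all of whose coordinates outside `t` are
nonnegative: the tangent cone of a simplex along the face spanned by `t`. -/
def tangentCone (L : ι → G → ℚ) (t : Finset ι) (m : G) : ℚ :=
  if ∀ j ∉ t, 0 ≤ L j m then 1 else 0

/-- The Brianchon–Gram identity for a simplex, with the empty face included. -/
lemma sum_neg_one_pow_card_smul_tangentCone (L : ι → G → ℚ) (hL : ∀ m, ∃ j, 0 ≤ L j m) :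
    ∑ t : Finset ι, (-1 : ℚ) ^ t.card • tangentCone L t = 0 := by
  ext m
  obtain ⟨j, hj⟩ := hL m
  have h := Finset.prod_sub (fun j => if 0 ≤ L j m then (1 : ℚ) else 0) (fun _ => 1) Finset.univ
  rw [Finset.prod_eq_zero (Finset.mem_univ j) (by simp [hj]), Finset.powerset_univ] at h
  simp only [Finset.sum_apply, Pi.smul_apply, smul_eq_mul, Pi.zero_apply]
  rw [h]
  refine Finset.sum_congr rfl fun t _ => ?_
  simp [tangentCone, Finset.prod_ite_zero]

variable [AddCommGroup G] (L : ι → G → ℚ) (w : ι → ι → G) (C : ι → ι → ℚ)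

lemma convolution_tangentCone_eq_zero
    (hw : ∀ i j, j ≠ i → ∀ l m, L l (m - w i j) =
      L l m - C i j * ((if l = j then 1 else 0) - if l = i then 1 else 0))
    {t : Finset ι} {i j : ι} (hi : i ∈ t) (hj : j ∈ t) (hij : j ≠ i) :
    convolution G (1 - AddMonoidAlgebra.single (w i j) 1) (tangentCone L t) = 0 := by
  ext m
  rw [convolution_one_sub_single, Pi.zero_apply, sub_eq_zero]
  unfold tangentCone
  congr 1
  refine propext (forall₂_congr fun l hl => ?_)
  rw [hw i j hij, if_neg (by grind), if_neg (by grind)]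
  simp

lemma convolution_prod_tangentCone_singleton (hC : ∀ i j, j ≠ i → 0 < C i j)
    (hw : ∀ i j, j ≠ i → ∀ l m, L l (m - w i j) =
      L l m - C i j * ((if l = j then 1 else 0) - if l = i then 1 else 0))
    (i : ι) (J : Finset ι) (hJ : i ∉ J) :
    convolution G (∏ j ∈ J, (1 - AddMonoidAlgebra.single (w i j) 1)) (tangentCone L {i}) =
      fun m => if (∀ l, l ≠ i → 0 ≤ L l m) ∧ ∀ l ∈ J, L l m < C i l then 1 else 0 := by
  induction J using Finset.induction_on with
  | empty => ext m; simp [tangentCone]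
  | insert j J hj ih =>
    have hji : j ≠ i := by grind
    ext m
    rw [Finset.prod_insert hj, map_mul, Module.End.mul_apply, ih (by grind),
      convolution_one_sub_single]
    have hCj := hC i j hji
    have hJw : (∀ l ∈ J, L l (m - w i j) < C i l) ↔ ∀ l ∈ J, L l m < C i l := by
      refine forall₂_congr fun l hl => ?_
      rw [hw i j hji, if_neg (by grind), if_neg (by grind)]
      simp
    have hKw : (∀ l, l ≠ i → 0 ≤ L l (m - w i j)) ↔
        (∀ l, l ≠ i → 0 ≤ L l m) ∧ C i j ≤ L j m := by
      have hj' : L j (m - w i j) = L j m - C i j := by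
        rw [hw i j hji, if_pos rfl, if_neg hji]; ring
      have hl' : ∀ l, l ≠ i → l ≠ j → L l (m - w i j) = L l m := fun l h h' => by
        rw [hw i j hji, if_neg h', if_neg h]; ring
      grind
    simp only [hJw, hKw, Finset.forall_mem_insert]
    by_cases hA : ∀ l, l ≠ i → 0 ≤ L l m <;> by_cases hB : ∀ l ∈ J, L l m < C i l <;>
      by_cases hc : L j m < C i j <;> simp [hA, hB, hc, not_le.mpr, not_lt.mp]

/-- Brion's identity with denominators cleared, in the group algebra `ℚ[G]`, where `L` are
barycentric coordinates on `G`. -/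
theorem prod_mul_simplex_eq_sum_prod_erase_mul (hL : ∀ m, ∃ j, 0 ≤ L j m)
    (hC : ∀ i j, j ≠ i → 0 < C i j)
    (hw : ∀ i j, j ≠ i → ∀ l m, L l (m - w i j) =
      L l m - C i j * ((if l = j then 1 else 0) - if l = i then 1 else 0))
    (s : AddMonoidAlgebra ℚ G) (hs : ∀ m, s.coeff m = if ∀ j, 0 ≤ L j m then 1 else 0)
    (p : ι → AddMonoidAlgebra ℚ G)
    (hp : ∀ i m, (p i).coeff m = if ∀ j, j ≠ i → 0 ≤ L j m ∧ L j m < C i j then 1 else 0) :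
    (∏ i, ∏ j ∈ Finset.univ.erase i, (1 - AddMonoidAlgebra.single (w i j) 1)) * s =
      ∑ i, (∏ k ∈ Finset.univ.erase i, ∏ j ∈ Finset.univ.erase k,
        (1 - AddMonoidAlgebra.single (w k j) 1)) * p i := by
  set q : ι → AddMonoidAlgebra ℚ G :=
    fun i => ∏ j ∈ Finset.univ.erase i, (1 - AddMonoidAlgebra.single (w i j) 1) with hq
  have hsc : (s.coeff : G → ℚ) = tangentCone L ∅ := by
    ext m; simp [hs, tangentCone]
  have hpc (i : ι) : ((p i).coeff : G → ℚ) = convolution G (q i) (tangentCone L {i}) := by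
    rw [hq, convolution_prod_tangentCone_singleton L w C hC hw i _ (by simp)]
    ext m
    rw [hp]
    congr 1
    simp [forall_and]
  have hzero (t : Finset ι) (ht : 1 < t.card) :
      convolution G (∏ i, q i) (tangentCone L t) = 0 := by
    obtain ⟨i, hi, j, hj, hij⟩ := Finset.one_lt_card.mp ht
    have hdvd : (1 - AddMonoidAlgebra.single (w i j) 1) ∣ ∏ i, q i :=
      (Finset.dvd_prod_of_mem (fun j => (1 - AddMonoidAlgebra.single (w i j) 1))
        (by simpa using hij.symm)).trans (Finset.dvd_prod_of_mem q (Finset.mem_univ i))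
    obtain ⟨r, hr⟩ := hdvd
    rw [hr, mul_comm, map_mul, Module.End.mul_apply,
      convolution_tangentCone_eq_zero L w C hw hi hj hij.symm, map_zero]
  have key := congrArg (convolution G (∏ i, q i)) (sum_neg_one_pow_card_smul_tangentCone L hL)
  simp only [map_sum, map_smul, map_zero] at key
  rw [← Finset.sum_subset (Finset.subset_univ
    (insert ∅ (Finset.univ.map ⟨singleton, Finset.singleton_injective⟩ : Finset (Finset ι)))),
    Finset.sum_insert (by simp), Finset.sum_map] at key
  · simp only [Finset.card_empty, pow_zero, one_smul, Function.Embedding.coeFn_mk,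
      Finset.card_singleton, pow_one, neg_smul, Finset.sum_neg_distrib, ← sub_eq_add_neg,
      sub_eq_zero, ← hsc] at key
    apply AddMonoidAlgebra.coeff_injective
    apply DFunLike.coe_injective
    rw [← convolution_coeff, key]
    simp only [AddMonoidAlgebra.coeff_sum, Finsupp.coe_finsetSum, ← convolution_coeff]
    refine Finset.sum_congr rfl fun i _ => ?_
    rw [hpc, ← Module.End.mul_apply, ← map_mul, Finset.prod_erase_mul _ _ (Finset.mem_univ i)]
  · intro t _ ht
    rw [hzero t, smul_zero]
    by_contra! h
    rcases Nat.le_one_iff_eq_zero_or_eq_one.mp h with h | h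
    · simp_all
    · obtain ⟨i, rfl⟩ := Finset.card_eq_one.mp h
      simp at ht

end Brion

/-- Barycentric coordinates with respect to `d + 1` affinely independent points of `ℚ^d`, written
as explicit affine forms `c j + ∑ k, a j k * x k`. -/
lemma exists_barycentric_coordinates {d : ℕ} {v : Fin (d + 1) → Fin d → ℚ}
    (hv : AffineIndependent ℚ v) :
    ∃ (c : Fin (d + 1) → ℚ) (a : Fin (d + 1) → Fin d → ℚ),
      (∀ i j, c j + ∑ k, a j k * v i k = if j = i then 1 else 0) ∧
      (∀ x : Fin d → ℚ, ∑ j, (c j + ∑ k, a j k * x k) = 1) ∧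
      ∀ (x : Fin d → ℚ) l, ∑ j, (c j + ∑ k, a j k * x k) * v j l = x l := by
  have htop : affineSpan ℚ (Set.range v) = ⊤ := by
    rw [hv.affineSpan_eq_top_iff_card_eq_finrank_add_one]; simp
  let b : AffineBasis (Fin (d + 1)) ℚ (Fin d → ℚ) := ⟨v, hv, htop⟩
  have hb (j) (x : Fin d → ℚ) : b.coord j 0 +
      ∑ k, (b.coord j).linear (fun l => if k = l then 1 else 0) * x k = b.coord j x := by
    have h := congrFun (AffineMap.decomp (b.coord j)) x
    rw [Pi.add_apply, LinearMap.pi_apply_eq_sum_univ] at h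
    rw [h, add_comm]
    simp [mul_comm]
  refine ⟨fun j => b.coord j 0,
    fun j k => (b.coord j).linear (fun l => if k = l then 1 else 0), fun i j => ?_, fun x => ?_,
    fun x l => ?_⟩
  · rw [hb]; exact b.coord_apply j i
  · simp only [hb]; exact b.sum_coord_apply_eq_one x
  · simp only [hb]
    have h := congrFun (b.linear_combination_coord_eq_self x) l
    rw [Finset.sum_apply] at h
    exact h

section Coordinates

variable {d : ℕ} {v : Fin (d + 1) → Fin d → ℚ} {c : Fin (d + 1) → ℚ} {a : Fin (d + 1) → Fin d → ℚ}

/-- Lattice points are bounded by their barycentric coordinates. -/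
lemma finite_setOf_coordinates_bounded
    (hsum : ∀ x : Fin d → ℚ, ∑ j, (c j + ∑ k, a j k * x k) = 1)
    (hrec : ∀ (x : Fin d → ℚ) l, ∑ j, (c j + ∑ k, a j k * x k) * v j l = x l)
    (i : Fin (d + 1)) (B : Fin (d + 1) → ℚ) :
    {m : Fin d → ℤ | ∀ j, j ≠ i →
      0 ≤ c j + ∑ k, a j k * (m k : ℚ) ∧ c j + ∑ k, a j k * (m k : ℚ) ≤ B j}.Finite := by
  set R : Fin d → ℤ := fun l => ⌈|v i l| + ∑ j ∈ Finset.univ.erase i, B j * |v j l - v i l|⌉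
    with hR
  refine (Set.finite_Icc (-R) R).subset fun m hm => ?_
  have hbound (l) : |(m l : ℚ)| ≤ |v i l| + ∑ j ∈ Finset.univ.erase i, B j * |v j l - v i l| := by
    have hml : (m l : ℚ) = v i l + ∑ j ∈ Finset.univ.erase i,
        (c j + ∑ k, a j k * (m k : ℚ)) * (v j l - v i l) := by
      rw [Finset.sum_erase _ (by simp)]
      simp only [mul_sub, Finset.sum_sub_distrib, ← Finset.sum_mul]
      rw [hrec (fun k => (m k : ℚ)), hsum (fun k => (m k : ℚ))]
      ring
    rw [hml]
    refine (abs_add_le _ _).trans (add_le_add le_rfl ((Finset.abs_sum_le_sum_abs _ _).trans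
      (Finset.sum_le_sum fun j hj => ?_)))
    obtain ⟨h0, h1⟩ := hm j (Finset.ne_of_mem_erase hj)
    rw [abs_mul, abs_of_nonneg h0]
    gcongr
  have hboundR (l) : |m l| ≤ R l := by
    have := (hbound l).trans (Int.le_ceil _)
    exact_mod_cast this
  exact ⟨fun l => (abs_le.mp (hboundR l)).1, fun l => (abs_le.mp (hboundR l)).2⟩

lemma cast_coordinates_apply
    (hdual : ∀ i j, c j + ∑ k, a j k * v i k = if j = i then 1 else 0) (i j : Fin (d + 1)) :
    (c j : ℝ) + ∑ k, (a j k : ℝ) * (v i k : ℝ) = if j = i then 1 else 0 := by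
  have h := congrArg (Rat.cast : ℚ → ℝ) (hdual i j)
  push_cast [apply_ite (Rat.cast : ℚ → ℝ)] at h
  exact h

lemma cast_mem_convexHull_iff
    (hdual : ∀ i j, c j + ∑ k, a j k * v i k = if j = i then 1 else 0)
    (hsum : ∀ x : Fin d → ℚ, ∑ j, (c j + ∑ k, a j k * x k) = 1)
    (hrec : ∀ (x : Fin d → ℚ) l, ∑ j, (c j + ∑ k, a j k * x k) * v j l = x l) (m : Fin d → ℤ) :
    (fun k => (m k : ℝ)) ∈ convexHull ℝ (Set.range fun i => fun k => (v i k : ℝ)) ↔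
      ∀ j, 0 ≤ c j + ∑ k, a j k * (m k : ℚ) := by
  constructor
  · intro h j
    have hconv : Convex ℝ {x : Fin d → ℝ | 0 ≤ (c j : ℝ) + ∑ k, (a j k : ℝ) * x k} := by
      intro x hx y hy s t hs ht hst
      simp only [Set.mem_ofPred_eq, Pi.add_apply, Pi.smul_apply, smul_eq_mul] at hx hy ⊢
      have : (c j : ℝ) + ∑ k, (a j k : ℝ) * (s * x k + t * y k) =
          s * (c j + ∑ k, (a j k : ℝ) * x k) + t * (c j + ∑ k, (a j k : ℝ) * y k) := by
        simp only [mul_add, Finset.mul_sum, Finset.sum_add_distrib]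
        simp only [mul_left_comm]
        linear_combination -(c j : ℝ) * hst
      rw [this]
      positivity
    have := convexHull_min (𝕜 := ℝ) (s := Set.range fun i => fun k => (v i k : ℝ)) (by
      rintro _ ⟨i, rfl⟩
      rw [Set.mem_ofPred_eq, cast_coordinates_apply hdual]
      split_ifs <;> norm_num) hconv h
    simp only [Set.mem_ofPred_eq] at this
    exact_mod_cast this
  · intro h
    refine mem_convexHull_of_exists_fintype
      (fun j => ((c j + ∑ k, a j k * (m k : ℚ) : ℚ) : ℝ)) (fun i k => (v i k : ℝ))
      (fun j => by exact_mod_cast h j) ?_ (fun i => ⟨i, rfl⟩) ?_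
    · exact_mod_cast hsum fun k => (m k : ℚ)
    · ext l
      simp only [Finset.sum_apply, Pi.smul_apply, smul_eq_mul]
      exact_mod_cast hrec (fun k => (m k : ℚ)) l

lemma cast_mem_parallelepiped_iff
    (hdual : ∀ i j, c j + ∑ k, a j k * v i k = if j = i then 1 else 0)
    (hsum : ∀ x : Fin d → ℚ, ∑ j, (c j + ∑ k, a j k * x k) = 1)
    (hrec : ∀ (x : Fin d → ℚ) l, ∑ j, (c j + ∑ k, a j k * x k) * v j l = x l)
    (i : Fin (d + 1)) {w : Fin (d + 1) → Fin d → ℤ} {C : Fin (d + 1) → ℚ}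
    (hC : ∀ j, j ≠ i → 0 < C j) (hw : ∀ j, j ≠ i → ∀ k, (w j k : ℚ) = C j * (v j k - v i k))
    (m : Fin d → ℤ) :
    (∃ t : Fin (d + 1) → ℝ, (∀ j, j ≠ i → 0 ≤ t j ∧ t j < 1) ∧
      (fun k => (m k : ℝ)) = (fun k => (v i k : ℝ)) +
        ∑ j ∈ Finset.univ.erase i, t j • (fun k => (w j k : ℝ))) ↔
      ∀ j, j ≠ i → 0 ≤ c j + ∑ k, a j k * (m k : ℚ) ∧ c j + ∑ k, a j k * (m k : ℚ) < C j := by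
  have hwR (j) (hj : j ≠ i) (k) : (w j k : ℝ) = C j * (v j k - v i k) := by
    exact_mod_cast congrArg (Rat.cast : ℚ → ℝ) (hw j hj k)
  constructor
  · rintro ⟨t, ht, hm⟩ j hj
    have hcoord : (c j : ℝ) + ∑ k, (a j k : ℝ) * (m k : ℝ) = t j * C j := by
      have hmk (k) : (m k : ℝ) = v i k + ∑ l ∈ Finset.univ.erase i, t l * w l k := by
        simpa using congrFun hm k
      have hwl (l) (hl : l ∈ Finset.univ.erase i) :
          ∑ k, (a j k : ℝ) * (t l * w l k) = if l = j then t j * C j else 0 := by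
        have hl' := Finset.ne_of_mem_erase hl
        have e1 := cast_coordinates_apply hdual l j
        have e2 := cast_coordinates_apply hdual i j
        have : ∑ k, (a j k : ℝ) * (t l * w l k) = t l * C l *
            ((c j + ∑ k, (a j k : ℝ) * v l k) - (c j + ∑ k, (a j k : ℝ) * v i k)) := by
          rw [add_sub_add_left_eq_sub, ← Finset.sum_sub_distrib, Finset.mul_sum]
          refine Finset.sum_congr rfl fun k _ => ?_
          rw [hwR l hl']; ring
        rw [this, e1, e2, if_neg hj]
        by_cases h : l = j
        · simp [h]
        · simp [h, Ne.symm h]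
      simp only [hmk, mul_add, Finset.sum_add_distrib, Finset.mul_sum]
      rw [Finset.sum_comm, Finset.sum_congr rfl hwl, ← add_assoc, cast_coordinates_apply hdual,
        if_neg hj]
      simp [hj]
    have hCj : (0 : ℝ) < C j := by exact_mod_cast hC j hj
    have h0 : 0 ≤ (c j : ℝ) + ∑ k, (a j k : ℝ) * (m k : ℝ) :=
      hcoord ▸ mul_nonneg (ht j hj).1 hCj.le
    have h1 : (c j : ℝ) + ∑ k, (a j k : ℝ) * (m k : ℝ) < C j :=
      hcoord ▸ mul_lt_of_lt_one_left hCj (ht j hj).2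
    exact ⟨by exact_mod_cast h0, by exact_mod_cast h1⟩
  · intro h
    refine ⟨fun j => (((c j + ∑ k, a j k * (m k : ℚ)) / C j : ℚ) : ℝ), fun j hj => ⟨?_, ?_⟩, ?_⟩
    · beta_reduce
      exact_mod_cast div_nonneg (h j hj).1 (hC j hj).le
    · beta_reduce
      exact_mod_cast (div_lt_one (hC j hj)).mpr (h j hj).2
    · ext l
      have key : (m l : ℚ) = v i l + ∑ j ∈ Finset.univ.erase i,
          ((c j + ∑ k, a j k * (m k : ℚ)) / C j) * w j l := by
        have : ∀ j ∈ Finset.univ.erase i, ((c j + ∑ k, a j k * (m k : ℚ)) / C j) * w j l =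
            (c j + ∑ k, a j k * (m k : ℚ)) * (v j l - v i l) := fun j hj => by
          have hj' := Finset.ne_of_mem_erase hj
          rw [hw j hj', ← mul_assoc, div_mul_cancel₀ _ (hC j hj').ne']
        rw [Finset.sum_congr rfl this, Finset.sum_erase _ (by simp)]
        simp only [mul_sub, Finset.sum_sub_distrib, ← Finset.sum_mul]
        rw [hrec (fun k => (m k : ℚ)), hsum (fun k => (m k : ℚ))]
        ring
      simp only [Pi.add_apply, Finset.sum_apply, Pi.smul_apply, smul_eq_mul]
      exact_mod_cast congrArg (Rat.cast : ℚ → ℝ) key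

end Coordinates

/-- The generating function of a finite set of lattice points, as a Laurent polynomial. -/
lemma finsum_mem_zpow {d : ℕ} {A : Set (Fin d → ℤ)} (hA : A.Finite) :
    ∑ᶠ m ∈ A, zpow d m = algebraMap (AddMonoidAlgebra ℚ (Fin d → ℤ)) _
      (∑ m ∈ hA.toFinset, AddMonoidAlgebra.single m 1) := by
  rw [finsum_mem_eq_finite_toFinset_sum _ hA, map_sum]
  rfl

lemma coeff_sum_single_one {G : Type*} [DecidableEq G] (A : Finset G) (m : G) :
    (∑ x ∈ A, AddMonoidAlgebra.single x (1 : ℚ)).coeff m = if m ∈ A then 1 else 0 := by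
  simp [AddMonoidAlgebra.coeff_sum, Finsupp.single_apply]

/-- **Brion's theorem for rational simplices.**  Let `S` be the convex hull of affinely
independent rational points `v₀, …, v_d ∈ ℚ^d` and, for each vertex `vᵢ`, choose nonzero
integer vectors `w i j` along the edge directions `v j - v i`.  Then the sum over the
vertices of the rational generating functions of the vertex cones, written via the
lattice points of the half-open fundamental parallelepipeds `Πᵢ`, equals the (Laurent
polynomial) generating function of `S ∩ ℤ^d`, as an identity in the fraction field of
`ℚ[z₁^{±1}, …, z_d^{±1}]`. -/
theorem brion_rational_simplex
    (d : ℕ) (hd : 1 ≤ d)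
    (v : Fin (d + 1) → Fin d → ℚ)
    (hAff : AffineIndependent ℚ v)
    -- integer edge vectors: `w i j` is a nonzero positive rational multiple of `v j - v i`
    (w : Fin (d + 1) → Fin (d + 1) → Fin d → ℤ)
    (hw : ∀ i j, j ≠ i → w i j ≠ 0 ∧
      ∃ c : ℚ, 0 < c ∧ ∀ k, (w i j k : ℚ) = c * (v j k - v i k)) :
    -- the half-open fundamental parallelepiped of the vertex cone at `v i`
    (∀ Par : Fin (d + 1) → Set (Fin d → ℝ),
      (∀ i, Par i = {x | ∃ t : Fin (d + 1) → ℝ,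
        (∀ j, j ≠ i → 0 ≤ t j ∧ t j < 1) ∧
        x = (fun k => ((v i k : ℝ))) +
          ∑ j ∈ Finset.univ.erase i, t j • (fun k => ((w i j k : ℝ)))}) →
      -- the simplex `S`
      ∀ S : Set (Fin d → ℝ),
        S = convexHull ℝ (Set.range fun i => (fun k => ((v i k : ℝ)))) →
        -- Brion's identity in the fraction field of the Laurent polynomial ring
        ∑ i : Fin (d + 1),
          (∑ᶠ m ∈ {m : Fin d → ℤ | (fun k => ((m k : ℝ))) ∈ Par i}, zpow d m) /
            ∏ j ∈ Finset.univ.erase i, (1 - zpow d (w i j))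
          = ∑ᶠ m ∈ {m : Fin d → ℤ | (fun k => ((m k : ℝ))) ∈ S}, zpow d m) := by
  classical
  intro Par hPar S hS
  obtain ⟨c, a, hdual, hsum, hrec⟩ := exists_barycentric_coordinates hAff
  have hw' : ∀ i j, ∃ C : ℚ, j ≠ i → 0 < C ∧ ∀ k, (w i j k : ℚ) = C * (v j k - v i k) :=
    fun i j => by
      by_cases h : j = i
      · exact ⟨0, fun h' => absurd h h'⟩
      · obtain ⟨C, hC⟩ := (hw i j h).2
        exact ⟨C, fun _ => hC⟩
  choose C hC using hw'
  set L : Fin (d + 1) → (Fin d → ℤ) → ℚ := fun j m => c j + ∑ k, a j k * (m k : ℚ) with hL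
  have hParMem (i) (m : Fin d → ℤ) : (fun k => (m k : ℝ)) ∈ Par i ↔
      ∀ j, j ≠ i → 0 ≤ L j m ∧ L j m < C i j := by
    rw [hPar]
    exact cast_mem_parallelepiped_iff hdual hsum hrec i (fun j hj => (hC i j hj).1)
      (fun j hj => (hC i j hj).2) m
  have hSMem (m : Fin d → ℤ) : (fun k => (m k : ℝ)) ∈ S ↔ ∀ j, 0 ≤ L j m := by
    rw [hS]
    exact cast_mem_convexHull_iff hdual hsum hrec m
  have hParFin (i) : {m : Fin d → ℤ | (fun k => (m k : ℝ)) ∈ Par i}.Finite :=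
    (finite_setOf_coordinates_bounded hsum hrec i (C i)).subset fun m hm j hj =>
      have h := (hParMem i m).mp hm j hj
      ⟨h.1, h.2.le⟩
  have hLsum (m) : ∑ j, L j m = 1 := hsum fun k => (m k : ℚ)
  have hSFin : {m : Fin d → ℤ | (fun k => (m k : ℝ)) ∈ S}.Finite :=
    (finite_setOf_coordinates_bounded hsum hrec 0 1).subset fun m hm j _ =>
      have h := (hSMem m).mp hm
      ⟨h j, (Finset.single_le_sum (fun j _ => h j) (Finset.mem_univ j)).trans (hLsum m).le⟩
  have hshift : ∀ i j, j ≠ i → ∀ l m, L l (m - w i j) =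
      L l m - C i j * ((if l = j then 1 else 0) - if l = i then 1 else 0) := fun i j hj l m => by
    have hwk := (hC i j hj).2
    rw [← hdual j l, ← hdual i l, add_sub_add_left_eq_sub, ← Finset.sum_sub_distrib,
      Finset.mul_sum]
    simp only [hL]
    rw [add_sub_assoc, ← Finset.sum_sub_distrib]
    congr 1
    refine Finset.sum_congr rfl fun k _ => ?_
    rw [Pi.sub_apply, Int.cast_sub, hwk]
    ring
  have main := prod_mul_simplex_eq_sum_prod_erase_mul L w C
    (fun m => by
      by_contra! h
      have := Finset.sum_nonpos fun j (_ : j ∈ Finset.univ) => (h j).le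
      rw [hLsum] at this
      norm_num at this)
    (fun i j hj => (hC i j hj).1) hshift
    (∑ m ∈ hSFin.toFinset, AddMonoidAlgebra.single m 1)
    (fun m => by rw [coeff_sum_single_one]; simp [hSMem])
    (fun i => ∑ m ∈ (hParFin i).toFinset, AddMonoidAlgebra.single m 1)
    (fun i m => by rw [coeff_sum_single_one]; simp [hParMem])
  have hne (i) : ∏ j ∈ Finset.univ.erase i, (1 - zpow d (w i j)) ≠ 0 := by
    refine Finset.prod_ne_zero_iff.mpr fun j hj h => ?_
    refine (hw i j (Finset.ne_of_mem_erase hj)).1 ?_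
    have h1 : zpow d 0 = zpow d (w i j) := (map_one _).trans (sub_eq_zero.mp h)
    have h2 := IsFractionRing.injective (AddMonoidAlgebra ℚ (Fin d → ℤ)) _ h1
    exact (AddMonoidAlgebra.single_left_injective one_ne_zero h2).symm
  have main' := congrArg (algebraMap (AddMonoidAlgebra ℚ (Fin d → ℤ))
    (FractionRing (AddMonoidAlgebra ℚ (Fin d → ℤ)))) main
  rw [map_mul, ← finsum_mem_zpow hSFin, map_sum] at main'
  simp only [map_mul, ← finsum_mem_zpow (hParFin _), map_prod, map_sub, map_one] at main'
  refine mul_left_cancel₀ (Finset.prod_ne_zero_iff.mpr fun i _ => hne i) (Eq.trans ?_ main'.symm)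
  rw [Finset.mul_sum]
  refine Finset.sum_congr rfl fun i _ => ?_
  rw [← Finset.prod_erase_mul _ _ (Finset.mem_univ i), mul_assoc, mul_div_cancel₀ _ (hne i)]
  rfl

end
end

section
/- (Groemer's extension theorem) Let X be a set, let L be a collection of subsets of X closed under pairwise unions and pairwise intersections, and let G₀ ⊆ L be a generating set of L: G₀ is closed under pairwise intersections and every element of L is a finite union of elements of G₀. Let M be an abelian group and let φ : G₀ → M satisfy the inclusion–exclusion relations: whenever A_1, …, A_n ∈ G₀ and A_1 ∪ ⋯ ∪ A_n ∈ G₀, one has φ(A_1 ∪ ⋯ ∪ A_n) = Σ_{∅ ≠ I ⊆ {1,…,n}} (−1)^{|I|+1} φ(⋂_{i∈I} A_i). Then there exists a unique valuation v : L → M (i.e., v(A ∪ B) + v(A ∩ B) = v(A) + v(B) for all A, B ∈ L) with v(A) = φ(A) for all A ∈ G₀. -/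
open Set

/-- The class of a set in the monoid algebra over `ℤ` of the sets under intersection. -/
noncomputable def setClass {X : Type*} (A : Set X) : MonoidAlgebra ℤ (AsBoolRing (Set X)) :=
  MonoidAlgebra.single (toBoolRing A) 1

/-- The additive extension of a function on sets to the monoid algebra of sets. -/
noncomputable def evalClass {X M : Type*} [AddCommGroup M] (φ : Set X → M) :
    MonoidAlgebra ℤ (AsBoolRing (Set X)) →ₗ[ℤ] M :=
  Finsupp.linearCombination ℤ (fun A => φ (ofBoolRing A)) ∘ₗ
    (MonoidAlgebra.coeffLinearEquiv ℤ).toLinearMap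

section SetClass

variable {X : Type*}

theorem evalClass_setClass {M : Type*} [AddCommGroup M] (φ : Set X → M) (A : Set X) :
    evalClass φ (setClass A) = φ A := by
  simp [evalClass, setClass]

theorem setClass_inter (A B : Set X) : setClass (A ∩ B) = setClass A * setClass B := by
  simp only [setClass, MonoidAlgebra.single_mul_single, mul_one]
  rfl

theorem setClass_mul_self (A : Set X) : setClass A * setClass A = setClass A := by
  rw [← setClass_inter, Set.inter_self]

theorem setClass_univ : setClass (Set.univ : Set X) = 1 := rfl

theorem setClass_biInter {ι : Type*} (s : Finset ι) (B : ι → Set X) :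
    setClass (⋂ i ∈ s, B i) = ∏ i ∈ s, setClass (B i) := by
  classical
  induction s using Finset.induction_on with
  | empty => simp [setClass_univ]
  | insert a s ha ih => rw [Finset.prod_insert ha, ← ih, ← setClass_inter, Finset.set_biInter_insert]

theorem prod_one_sub_mul_of_idempotent {R ι : Type*} [CommRing R] (s : Finset ι) (a : ι → R)
    {e : R} (he : e * e = e) :
    ∏ i ∈ s, (1 - a i * e) = 1 - (1 - ∏ i ∈ s, (1 - a i)) * e := by
  classical
  induction s using Finset.induction_on with
  | empty => simp
  | insert j s hj ih =>
    rw [Finset.prod_insert hj, Finset.prod_insert hj, ih]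
    linear_combination a j * (1 - ∏ i ∈ s, (1 - a i)) * he

/-- The class of the complement of the union of a finite family, expanded as a product. -/
noncomputable def unionCompl {ι : Type*} [Fintype ι] (B : ι → Set X) :
    MonoidAlgebra ℤ (AsBoolRing (Set X)) :=
  ∏ i, (1 - setClass (B i))

theorem unionCompl_mul_self {ι : Type*} [Fintype ι] (B : ι → Set X) :
    unionCompl B * unionCompl B = unionCompl B := by
  rw [unionCompl, ← Finset.prod_mul_distrib]
  refine Finset.prod_congr rfl fun i _ => ?_
  linear_combination setClass_mul_self (B i)

theorem unionCompl_inter {ι : Type*} [Fintype ι] (B : ι → Set X) (C : Set X) :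
    unionCompl (fun i => B i ∩ C) = 1 - (1 - unionCompl B) * setClass C := by
  simp only [unionCompl, setClass_inter]
  exact prod_one_sub_mul_of_idempotent _ _ (setClass_mul_self C)

theorem unionCompl_sumElim {ι κ : Type*} [Fintype ι] [Fintype κ] (B : ι → Set X) (C : κ → Set X) :
    unionCompl (Sum.elim B C) = unionCompl B * unionCompl C := by
  simp [unionCompl, Fintype.prod_sum_type]

theorem unionCompl_prod_inter {ι κ : Type*} [Fintype ι] [Fintype κ]
    (B : ι → Set X) (C : κ → Set X) :
    unionCompl (fun x : ι × κ => B x.1 ∩ C x.2) = 1 - (1 - unionCompl B) * (1 - unionCompl C) := by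
  have hC : (1 - unionCompl C) * (1 - unionCompl C) = 1 - unionCompl C := by
    linear_combination unionCompl_mul_self C
  rw [unionCompl, Fintype.prod_prod_type, unionCompl, ← prod_one_sub_mul_of_idempotent _ _ hC]
  refine Finset.prod_congr rfl fun i _ => ?_
  have h := unionCompl_inter C (B i)
  simp only [unionCompl, Set.inter_comm _ (B i)] at h ⊢
  rw [h, mul_comm]

theorem one_sub_unionCompl {ι : Type*} [Fintype ι] (B : ι → Set X) :
    1 - unionCompl B =
      ∑ I ∈ Finset.univ.powerset.filter (fun I : Finset ι => I.Nonempty),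
        (-1 : ℤ) ^ (I.card + 1) • setClass (⋂ i ∈ I, B i) := by
  classical
  have hfilter : Finset.univ.powerset.filter (fun I : Finset ι => I.Nonempty) =
      Finset.univ.powerset.erase ∅ := by
    ext I; simp [Finset.nonempty_iff_ne_empty]
  have hprod : unionCompl B =
      ∑ I ∈ Finset.univ.powerset, (-1 : ℤ) ^ I.card • setClass (⋂ i ∈ I, B i) := by
    simp only [unionCompl, sub_eq_add_neg, Finset.prod_one_add, Finset.prod_neg, setClass_biInter]
    simp [zsmul_eq_mul]
  rw [hfilter, hprod, ← Finset.add_sum_erase _ _ (Finset.empty_mem_powerset _)]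
  simp [setClass_univ, pow_succ]

end SetClass

section InclusionExclusion

variable {X M : Type*} [AddCommGroup M] {G₀ : Set (Set X)} {φ : Set X → M}

theorem evalClass_setClass_mul_unionCompl
    (hinter : ∀ A ∈ G₀, ∀ B ∈ G₀, A ∩ B ∈ G₀)
    (hφ : ∀ (n : ℕ) (B : Fin (n + 1) → Set X), (∀ i, B i ∈ G₀) → (⋃ i, B i) ∈ G₀ →
      φ (⋃ i, B i) = evalClass φ (1 - unionCompl B))
    {ι : Type*} [Fintype ι] [Nonempty ι] {B : ι → Set X} (hB : ∀ i, B i ∈ G₀)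
    {C : Set X} (hC : C ∈ G₀) (hCB : C ⊆ ⋃ i, B i) :
    evalClass φ (setClass C * unionCompl B) = 0 := by
  obtain ⟨n, hn⟩ := Nat.exists_eq_succ_of_ne_zero (Fintype.card_ne_zero (α := ι))
  let e : Fin (n + 1) ≃ ι := (finCongr hn.symm).trans (Fintype.equivFin ι).symm
  have hU : ⋃ i, B (e i) ∩ C = C := by
    rw [e.surjective.iUnion_comp (fun i => B i ∩ C), ← Set.iUnion_inter]
    exact Set.inter_eq_right.2 hCB
  have h := hφ n (fun i => B (e i) ∩ C) (fun i => hinter _ (hB _) _ hC) (hU.symm ▸ hC)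
  have he : unionCompl (fun i => B (e i)) = unionCompl B :=
    e.prod_comp (fun i => 1 - setClass (B i))
  rw [hU, unionCompl_inter (fun i => B (e i)), he, ← evalClass_setClass φ C] at h
  rw [show setClass C * unionCompl B =
    setClass C - (1 - (1 - (1 - unionCompl B) * setClass C)) by ring, map_sub, ← h, sub_self]

theorem evalClass_unionCompl_mul
    (hinter : ∀ A ∈ G₀, ∀ B ∈ G₀, A ∩ B ∈ G₀)
    (hφ : ∀ (n : ℕ) (B : Fin (n + 1) → Set X), (∀ i, B i ∈ G₀) → (⋃ i, B i) ∈ G₀ →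
      φ (⋃ i, B i) = evalClass φ (1 - unionCompl B))
    {ι κ : Type*} [Fintype ι] [Nonempty ι] [Fintype κ]
    {B : ι → Set X} (hB : ∀ i, B i ∈ G₀) {C : κ → Set X} (hC : ∀ j, C j ∈ G₀)
    (hCB : ⋃ j, C j ⊆ ⋃ i, B i) :
    evalClass φ (unionCompl B * unionCompl C) = evalClass φ (unionCompl B) := by
  classical
  have hzero : ∀ (s : Finset κ) (D : Set X), D ∈ G₀ → D ⊆ ⋃ i, B i →
      evalClass φ (setClass D * unionCompl B * ∏ j ∈ s, (1 - setClass (C j))) = 0 := by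
    intro s
    induction s using Finset.induction_on with
    | empty =>
      intro D hD hDB
      simpa using evalClass_setClass_mul_unionCompl hinter hφ hB hD hDB
    | insert k s hk ih =>
      intro D hD hDB
      have h := ih (D ∩ C k) (hinter _ hD _ (hC k)) (Set.inter_subset_left.trans hDB)
      rw [setClass_inter] at h
      rw [Finset.prod_insert hk, show ∀ d c p q : MonoidAlgebra ℤ (AsBoolRing (Set X)),
        d * p * ((1 - c) * q) = d * p * q - d * c * p * q by intros; ring, map_sub,
        ih D hD hDB, h, sub_self]
  suffices ∀ s : Finset κ, evalClass φ (unionCompl B * ∏ j ∈ s, (1 - setClass (C j))) =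
      evalClass φ (unionCompl B) from this Finset.univ
  intro s
  induction s using Finset.induction_on with
  | empty => simp
  | insert k s hk ih =>
    rw [Finset.prod_insert hk, show ∀ c p q : MonoidAlgebra ℤ (AsBoolRing (Set X)),
      p * ((1 - c) * q) = p * q - c * p * q by intros; ring, map_sub, ih,
      hzero s (C k) (hC k) ((Set.subset_iUnion C k).trans hCB), sub_zero]

theorem evalClass_unionCompl_congr
    (hinter : ∀ A ∈ G₀, ∀ B ∈ G₀, A ∩ B ∈ G₀)
    (hφ : ∀ (n : ℕ) (B : Fin (n + 1) → Set X), (∀ i, B i ∈ G₀) → (⋃ i, B i) ∈ G₀ →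
      φ (⋃ i, B i) = evalClass φ (1 - unionCompl B))
    {ι κ : Type*} [Fintype ι] [Nonempty ι] [Fintype κ] [Nonempty κ]
    {B : ι → Set X} (hB : ∀ i, B i ∈ G₀) {C : κ → Set X} (hC : ∀ j, C j ∈ G₀)
    (h : ⋃ i, B i = ⋃ j, C j) :
    evalClass φ (unionCompl B) = evalClass φ (unionCompl C) := by
  rw [← evalClass_unionCompl_mul hinter hφ hB hC h.ge, mul_comm,
    evalClass_unionCompl_mul hinter hφ hC hB h.le]

end InclusionExclusion

/-- Two valuations on a lattice of sets agreeing on an intersection-closed subset agree on the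
nonempty finite unions of its elements. -/
theorem valuation_iUnion_eq {X M : Type*} [AddCommGroup M] {L G₀ : Set (Set X)}
    (hunion : ∀ A ∈ L, ∀ B ∈ L, A ∪ B ∈ L) (hsub : G₀ ⊆ L)
    (hinter : ∀ A ∈ G₀, ∀ B ∈ G₀, A ∩ B ∈ G₀) {v w : Set X → M}
    (hv : ∀ A ∈ L, ∀ B ∈ L, v (A ∪ B) + v (A ∩ B) = v A + v B)
    (hw : ∀ A ∈ L, ∀ B ∈ L, w (A ∪ B) + w (A ∩ B) = w A + w B)
    (hvw : ∀ A ∈ G₀, v A = w A) (n : ℕ) (B : Fin (n + 1) → Set X) (hB : ∀ i, B i ∈ G₀) :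
    (⋃ i, B i) ∈ L ∧ v (⋃ i, B i) = w (⋃ i, B i) := by
  induction n with
  | zero =>
    have h : ⋃ i, B i = B 0 := iSup_unique (ι := Fin 1) B
    rw [h]
    exact ⟨hsub (hB 0), hvw _ (hB 0)⟩
  | succ n ih =>
    have hU : ⋃ i, B i = B 0 ∪ ⋃ i : Fin (n + 1), B i.succ := by
      ext x; simp [Fin.exists_fin_succ]
    obtain ⟨hmem, heq⟩ := ih (fun i => B i.succ) fun i => hB _
    obtain ⟨-, heq'⟩ := ih (fun i => B 0 ∩ B i.succ) fun i => hinter _ (hB 0) _ (hB _)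
    rw [← Set.inter_iUnion] at heq'
    have h0 := hsub (hB 0)
    rw [hU]
    refine ⟨hunion _ h0 _ hmem, ?_⟩
    rw [eq_sub_of_add_eq (hv _ h0 _ hmem), eq_sub_of_add_eq (hw _ h0 _ hmem), heq, heq',
      hvw _ (hB 0)]

/-- **Groemer's extension theorem.**  Let `L` be a lattice of subsets of `X` generated
by `G₀` (i.e. `G₀` is closed under pairwise intersections and every element of `L` is a
finite union of elements of `G₀`).  If `φ : G₀ → M` satisfies the inclusion–exclusion
relations whenever a finite union of elements of `G₀` again lies in `G₀`, then `φ`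
extends uniquely to a valuation on `L`. -/
theorem groemer_extension
    {X : Type*} {M : Type*} [AddCommGroup M]
    (L G₀ : Set (Set X))
    -- `L` is a lattice of sets
    (hLunion : ∀ A ∈ L, ∀ B ∈ L, A ∪ B ∈ L)
    (hLinter : ∀ A ∈ L, ∀ B ∈ L, A ∩ B ∈ L)
    -- `G₀` is a generating set of `L`
    (hG₀L : G₀ ⊆ L)
    (hG₀inter : ∀ A ∈ G₀, ∀ B ∈ G₀, A ∩ B ∈ G₀)
    (hgen : ∀ A ∈ L, ∃ (n : ℕ) (B : Fin (n + 1) → Set X),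
      (∀ i, B i ∈ G₀) ∧ A = ⋃ i, B i)
    -- `φ` satisfies the inclusion–exclusion relations on `G₀`
    (φ : Set X → M)
    (hφ : ∀ (n : ℕ) (B : Fin (n + 1) → Set X), (∀ i, B i ∈ G₀) → (⋃ i, B i) ∈ G₀ →
      φ (⋃ i, B i)
        = ∑ I ∈ Finset.univ.powerset.filter
            (fun I : Finset (Fin (n + 1)) => I.Nonempty),
            (-1 : ℤ) ^ (I.card + 1) • φ (⋂ i ∈ I, B i)) :
    ∃ vfun : Set X → M,
      ((∀ A ∈ L, ∀ B ∈ L, vfun (A ∪ B) + vfun (A ∩ B) = vfun A + vfun B) ∧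
        (∀ A ∈ G₀, vfun A = φ A)) ∧
      ∀ wfun : Set X → M,
        ((∀ A ∈ L, ∀ B ∈ L, wfun (A ∪ B) + wfun (A ∩ B) = wfun A + wfun B) ∧
          (∀ A ∈ G₀, wfun A = φ A)) →
        ∀ A ∈ L, wfun A = vfun A := by
  classical
  have hφ' : ∀ (n : ℕ) (B : Fin (n + 1) → Set X), (∀ i, B i ∈ G₀) → (⋃ i, B i) ∈ G₀ →
      φ (⋃ i, B i) = evalClass φ (1 - unionCompl B) := by
    intro n B hB hU
    rw [hφ n B hB hU, one_sub_unionCompl, map_sum]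
    refine Finset.sum_congr (by congr) fun I _ => ?_
    rw [map_zsmul, evalClass_setClass]
  choose! n B hB hAB using hgen
  have hval : ∀ A ∈ L, ∀ {ι : Type} [Fintype ι] [Nonempty ι] (C : ι → Set X),
      (∀ i, C i ∈ G₀) → A = ⋃ i, C i →
      evalClass φ (1 - unionCompl (B A)) = evalClass φ (1 - unionCompl C) := by
    intro A hA ι _ _ C hC hAC
    rw [map_sub, map_sub, evalClass_unionCompl_congr hG₀inter hφ' (hB A hA) hC
      ((hAB A hA).symm.trans hAC)]
  have hv : ∀ A ∈ L, ∀ C ∈ L,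
      evalClass φ (1 - unionCompl (B (A ∪ C))) + evalClass φ (1 - unionCompl (B (A ∩ C))) =
        evalClass φ (1 - unionCompl (B A)) + evalClass φ (1 - unionCompl (B C)) := by
    intro A hA C hC
    rw [hval _ (hLunion A hA C hC) (Sum.elim (B A) (B C))
        (by rintro (i | i); exacts [hB A hA i, hB C hC i])
        (by rw [Set.iUnion_sum]; exact congrArg₂ _ (hAB A hA) (hAB C hC)),
      hval _ (hLinter A hA C hC) (fun x : Fin (n A + 1) × Fin (n C + 1) => B A x.1 ∩ B C x.2)
        (fun x => hG₀inter _ (hB A hA _) _ (hB C hC _))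
        (by rw [Set.iUnion_prod', ← Set.iUnion_inter_iUnion, ← hAB A hA, ← hAB C hC]),
      unionCompl_sumElim, unionCompl_prod_inter, ← map_add, ← map_add]
    congr 1
    ring
  have hext : ∀ A ∈ G₀, evalClass φ (1 - unionCompl (B A)) = φ A := by
    intro A hA
    rw [hval A (hG₀L hA) (fun _ : Unit => A) (fun _ => hA) (Set.iUnion_const A).symm]
    simp [unionCompl, evalClass_setClass]
  refine ⟨fun A => evalClass φ (1 - unionCompl (B A)), ⟨hv, hext⟩, ?_⟩
  rintro w ⟨hw, hwφ⟩ A hA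
  have h := (valuation_iUnion_eq hLunion hG₀L hG₀inter hw hv
    (fun A hA => (hwφ A hA).trans (hext A hA).symm) (n A) (B A) (hB A hA)).2
  rwa [← hAB A hA] at h
end

section
/- Let X be a set, let L be a collection of subsets of X closed under pairwise unions and pairwise intersections, and let G₀ ⊆ L be a generating set of L: G₀ is closed under pairwise intersections and every element of L is a finite union of elements of G₀. If v and w are two valuations on L with values in an abelian group M (i.e., each satisfies v(A ∪ B) + v(A ∩ B) = v(A) + v(B) for all A, B ∈ L) and v(A) = w(A) for all A ∈ G₀, then v = w on all of L. In particular, two valuations that agree on all simplices of a triangulation agree on all unions of faces of that triangulation. -/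
open Set

theorem Fin.iUnion_eq_zero_union_succ {X : Type*} {n : ℕ} (B : Fin (n + 1) → Set X) :
    ⋃ i, B i = B 0 ∪ ⋃ i : Fin n, B i.succ := by
  ext x
  simp [Fin.exists_fin_succ]

theorem iUnion_fin_mem_of_union_mem {X : Type*} {L : Set (Set X)}
    (hL : ∀ A ∈ L, ∀ B ∈ L, A ∪ B ∈ L) (n : ℕ) (B : Fin (n + 1) → Set X)
    (hB : ∀ i, B i ∈ L) : ⋃ i, B i ∈ L := by
  induction n with
  | zero => simpa [Fin.iUnion_eq_zero_union_succ] using hB 0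
  | succ n ih =>
    rw [Fin.iUnion_eq_zero_union_succ]
    exact hL _ (hB 0) _ (ih _ fun i => hB i.succ)

/-- Two valuations on a lattice of sets `L` that agree on a generating set `G₀` agree
on all of `L`.  (In particular, two valuations that agree on all simplices of a
triangulation agree on all unions of faces of the triangulation.) -/
theorem valuations_agree_of_agree_on_generators
    {X : Type*} {M : Type*} [AddCommGroup M]
    (L G₀ : Set (Set X))
    -- `L` is a lattice of sets
    (hLunion : ∀ A ∈ L, ∀ B ∈ L, A ∪ B ∈ L)
    (hLinter : ∀ A ∈ L, ∀ B ∈ L, A ∩ B ∈ L)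
    -- `G₀` is a generating set of `L`
    (hG₀L : G₀ ⊆ L)
    (hG₀inter : ∀ A ∈ G₀, ∀ B ∈ G₀, A ∩ B ∈ G₀)
    (hgen : ∀ A ∈ L, ∃ (n : ℕ) (B : Fin (n + 1) → Set X),
      (∀ i, B i ∈ G₀) ∧ A = ⋃ i, B i)
    -- `v` and `w` are valuations on `L`
    (v w : Set X → M)
    (hv : ∀ A ∈ L, ∀ B ∈ L, v (A ∪ B) + v (A ∩ B) = v A + v B)
    (hw : ∀ A ∈ L, ∀ B ∈ L, w (A ∪ B) + w (A ∩ B) = w A + w B)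
    -- `v` and `w` agree on `G₀`
    (hagree : ∀ A ∈ G₀, v A = w A) :
    ∀ A ∈ L, v A = w A := by
  suffices h : ∀ (n : ℕ) (B : Fin (n + 1) → Set X), (∀ i, B i ∈ G₀) →
      v (⋃ i, B i) = w (⋃ i, B i) by
    intro A hA
    obtain ⟨n, B, hB, rfl⟩ := hgen A hA
    exact h n B hB
  intro n
  induction n with
  | zero =>
    intro B hB
    simpa [Fin.iUnion_eq_zero_union_succ] using hagree _ (hB 0)
  | succ n ih =>
    intro B hB
    have hU := iUnion_fin_mem_of_union_mem hLunion n _ fun i => hG₀L (hB i.succ)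
    have hinter := ih (fun i => B 0 ∩ B i.succ) fun i => hG₀inter _ (hB 0) _ (hB i.succ)
    rw [← inter_iUnion] at hinter
    rw [Fin.iUnion_eq_zero_union_succ, eq_sub_of_add_eq (hv _ (hG₀L (hB 0)) _ hU),
      eq_sub_of_add_eq (hw _ (hG₀L (hB 0)) _ hU), hagree _ (hB 0),
      ih _ fun i => hB i.succ, hinter]
end
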